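/- arXiv:2109.05291 — 2 statements merged into one kernel-verified Lean document; each statement's English description precedes it below -/
import Mathlib

section
/- Let a_n denote the number of (3,0)-threshold sequences of length n and b_n the number of (3,1)-threshold sequences of length n, with the conventions a_0 = b_0 = 1. Then for every integer n ≥ 2, b_n = 3·b_{n−1} + Σ_{h=1}^{n−2} (a_h + b_h)·b_{n−h−1} + a_{n−1}. -/
/-- `a n` is the number of (3,0)-threshold sequences of length `n`, with `a 0 = 1`. -/
noncomputable def a (n : ℕ) : ℕ :=
  if n = 0 then 1 else
    Set.ncard {s : Fin n → ℤ | StrictMono s ∧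
      ∀ i : Fin n, 3 * ((i : ℤ) + 1) ≤ s i ∧ s i ≤ 3 * n}

/-- `b n` is the number of (3,1)-threshold sequences of length `n`, with `b 0 = 1`. -/
noncomputable def b (n : ℕ) : ℕ :=
  if n = 0 then 1 else
    Set.ncard {s : Fin n → ℤ | StrictMono s ∧
      ∀ i : Fin n, 3 * ((i : ℤ) + 1) ≤ s i ∧ s i ≤ 3 * n + 1}

/-- The strictly increasing integer sequences `s` of length `n` with `3 i ≤ s_i ≤ 3 n + l`. -/
def thresholdSet (n l : ℕ) : Set (Fin n → ℤ) :=
  {s | StrictMono s ∧ ∀ i : Fin n, 3 * ((i : ℤ) + 1) ≤ s i ∧ s i ≤ 3 * n + l}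

/-- The number of `(3, l)`-threshold sequences of length `n`, defined recursively. -/
def thresholdCount : ℕ → ℕ → ℕ
  | 0, _ => 1
  | n + 1, 0 => thresholdCount n 2
  | n + 1, l + 1 => thresholdCount (n + 1) l + thresholdCount n (l + 3)

theorem thresholdSet_finite (n l : ℕ) : (thresholdSet n l).Finite := by
  refine (Set.finite_Icc (fun _ : Fin n => (0 : ℤ)) (fun _ => 3 * n + l)).subset ?_
  rintro s ⟨-, hs⟩
  refine ⟨fun i => ?_, fun i => (hs i).2⟩
  have := (hs i).1
  change 0 ≤ s i
  omega

theorem strictMono_snoc_iff {α : Type*} [Preorder α] {n : ℕ} {s : Fin n → α} {x : α} :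
    StrictMono (Fin.snoc s x : Fin (n + 1) → α) ↔ StrictMono s ∧ ∀ i, s i < x := by
  constructor
  · intro h
    refine ⟨fun i j hij => ?_, fun i => ?_⟩
    · simpa using h (Fin.castSucc_lt_castSucc_iff.2 hij)
    · simpa using h (Fin.castSucc_lt_last i)
  · rintro ⟨h, hx⟩ i j hij
    induction j using Fin.lastCases with
    | last =>
      induction i using Fin.lastCases with
      | last => exact absurd hij (lt_irrefl _)
      | cast i => simpa using hx i
    | cast j =>
      induction i using Fin.lastCases with
      | last => exact absurd hij (Fin.castSucc_lt_last j).not_gt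
      | cast i => simpa using h (Fin.castSucc_lt_castSucc_iff.1 hij)

theorem snoc_mem_thresholdSet_iff {n l : ℕ} {s : Fin n → ℤ} {x : ℤ} :
    (Fin.snoc s x : Fin (n + 1) → ℤ) ∈ thresholdSet (n + 1) l ↔
      StrictMono s ∧ (∀ i : Fin n, 3 * ((i : ℤ) + 1) ≤ s i ∧ s i < x) ∧
        3 * ((n : ℤ) + 1) ≤ x ∧ x ≤ 3 * ((n : ℤ) + 1) + l := by
  simp only [thresholdSet, Set.mem_ofPred_eq, strictMono_snoc_iff, Fin.forall_fin_succ',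
    Fin.snoc_castSucc, Fin.snoc_last, Fin.val_castSucc, Fin.val_last, Nat.cast_add, Nat.cast_one]
  constructor
  · rintro ⟨⟨h, hx⟩, hs, hl⟩
    exact ⟨h, fun i => ⟨(hs i).1, hx i⟩, hl⟩
  · rintro ⟨h, hs, hl⟩
    exact ⟨⟨h, fun i => (hs i).2⟩, fun i => ⟨(hs i).1, (hs i).2.le.trans hl.2⟩, hl⟩

theorem snoc_max_mem_thresholdSet_iff {n l : ℕ} {s : Fin n → ℤ} :
    (Fin.snoc s (3 * ((n : ℤ) + 1) + l) : Fin (n + 1) → ℤ) ∈ thresholdSet (n + 1) l ↔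
      s ∈ thresholdSet n (l + 2) := by
  rw [snoc_mem_thresholdSet_iff]
  simp only [thresholdSet, Set.mem_ofPred_eq, Nat.cast_add, Nat.cast_ofNat]
  constructor
  · rintro ⟨h, hs, -⟩
    exact ⟨h, fun i => ⟨(hs i).1, by have := (hs i).2; omega⟩⟩
  · rintro ⟨h, hs⟩
    exact ⟨h, fun i => ⟨(hs i).1, by have := (hs i).2; omega⟩, by omega, le_rfl⟩

theorem ncard_snoc_image (n l : ℕ) (x : ℤ) :
    ((fun s : Fin n → ℤ => (Fin.snoc s x : Fin (n + 1) → ℤ)) '' thresholdSet n l).ncard =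
      (thresholdSet n l).ncard :=
  Set.ncard_image_of_injective _ (Fin.snoc_left_injective (α := fun _ => ℤ) x)

theorem thresholdSet_succ_zero (n : ℕ) :
    thresholdSet (n + 1) 0 = (fun s : Fin n → ℤ =>
      (Fin.snoc s (3 * ((n : ℤ) + 1) + (0 : ℕ)) : Fin (n + 1) → ℤ)) '' thresholdSet n 2 := by
  ext t
  constructor
  · induction t using Fin.snocCases with
    | snoc s x =>
      intro h
      obtain rfl : x = 3 * ((n : ℤ) + 1) + (0 : ℕ) := by
        have := (snoc_mem_thresholdSet_iff.1 h).2.2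
        omega
      exact ⟨s, snoc_max_mem_thresholdSet_iff.1 h, rfl⟩
  · rintro ⟨s, hs, rfl⟩
    exact snoc_max_mem_thresholdSet_iff.2 hs

theorem thresholdSet_succ_succ (n l : ℕ) :
    thresholdSet (n + 1) (l + 1) = thresholdSet (n + 1) l ∪ (fun s : Fin n → ℤ =>
      (Fin.snoc s (3 * ((n : ℤ) + 1) + (l + 1 : ℕ)) : Fin (n + 1) → ℤ)) ''
        thresholdSet n (l + 3) := by
  ext t
  constructor
  · induction t using Fin.snocCases with
    | snoc s x =>
      intro h
      obtain ⟨hmono, hs, hx, hx'⟩ := snoc_mem_thresholdSet_iff.1 h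
      rcases hx'.eq_or_lt with rfl | hlt
      · exact Or.inr ⟨s, snoc_max_mem_thresholdSet_iff.1 h, rfl⟩
      · exact Or.inl (snoc_mem_thresholdSet_iff.2 ⟨hmono, hs, hx, by omega⟩)
  · rintro (⟨hmono, ht⟩ | ⟨s, hs, rfl⟩)
    · exact ⟨hmono, fun i => ⟨(ht i).1, (ht i).2.trans (by omega)⟩⟩
    · exact snoc_max_mem_thresholdSet_iff.2 hs

theorem disjoint_thresholdSet_snoc_image (n l : ℕ) :
    Disjoint (thresholdSet (n + 1) l) ((fun s : Fin n → ℤ =>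
      (Fin.snoc s (3 * ((n : ℤ) + 1) + (l + 1 : ℕ)) : Fin (n + 1) → ℤ)) ''
        thresholdSet n (l + 3)) := by
  rw [Set.disjoint_right]
  rintro _ ⟨s, -, rfl⟩ h
  have := (snoc_mem_thresholdSet_iff.1 h).2.2.2
  omega

theorem ncard_thresholdSet (n l : ℕ) : (thresholdSet n l).ncard = thresholdCount n l := by
  induction n generalizing l with
  | zero =>
    have : thresholdSet 0 l = Set.univ :=
      Set.eq_univ_of_forall fun s => ⟨fun i => i.elim0, fun i => i.elim0⟩
    simp [this, thresholdCount]
  | succ n ihn =>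
    induction l with
    | zero => rw [thresholdSet_succ_zero, ncard_snoc_image, ihn, thresholdCount]
    | succ l ihl =>
      rw [thresholdSet_succ_succ, Set.ncard_union_eq (disjoint_thresholdSet_snoc_image n l)
        (thresholdSet_finite _ _) ((thresholdSet_finite _ _).image _), ncard_snoc_image, ihn, ihl,
        thresholdCount]

/-- In terms of generating functions: the `(3, l)`-threshold numbers are the coefficients of
`T ^ (l + 1)`, where `T = 1 + x T ^ 3`. -/
theorem sum_antidiagonal_thresholdCount (n l m : ℕ) :
    ∑ p ∈ Finset.HasAntidiagonal.antidiagonal n, thresholdCount p.1 l * thresholdCount p.2 m =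
      thresholdCount n (l + m + 1) := by
  induction n generalizing l m with
  | zero => simp [thresholdCount]
  | succ n ihn =>
    induction l with
    | zero =>
      simp only [Finset.Nat.sum_antidiagonal_succ, thresholdCount, ihn, one_mul, zero_add]
      congr 2
      omega
    | succ l ihl =>
      rw [Finset.Nat.sum_antidiagonal_succ] at ihl ⊢
      simp only [thresholdCount, add_mul, Finset.sum_add_distrib, ihn] at ihl ⊢
      rw [← add_assoc, ihl, show l + 1 + m = l + m + 1 by omega,
        show l + 3 + m + 1 = l + m + 1 + 3 by omega]
      simp only [thresholdCount]

theorem a_eq_thresholdCount (n : ℕ) : a n = thresholdCount n 0 := by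
  rcases n with _ | n
  · simp [a, thresholdCount]
  · simp [a, ← ncard_thresholdSet, thresholdSet]

theorem b_eq_thresholdCount (n : ℕ) : b n = thresholdCount n 1 := by
  rcases n with _ | n
  · simp [b, thresholdCount]
  · simp [b, ← ncard_thresholdSet, thresholdSet]

theorem b_succ_eq_sum_antidiagonal (n : ℕ) :
    b (n + 1) = ∑ p ∈ Finset.HasAntidiagonal.antidiagonal n, (a p.1 + b p.1) * b p.2 := by
  simp only [a_eq_thresholdCount, b_eq_thresholdCount, add_mul, Finset.sum_add_distrib,
    sum_antidiagonal_thresholdCount]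
  simp only [thresholdCount]

/-- b_n = 3·b_{n-1} + Σ_{h=1}^{n-2} (a_h + b_h)·b_{n-h-1} + a_{n-1} for n ≥ 2. -/
theorem b_recurrence (n : ℕ) (hn : 2 ≤ n) :
    b n = 3 * b (n - 1) + (∑ h ∈ Finset.Icc 1 (n - 2), (a h + b h) * b (n - h - 1))
        + a (n - 1) := by
  obtain ⟨k, rfl⟩ := Nat.exists_eq_add_of_le' hn
  have ha : a 0 = 1 := by simp [a]
  have hb : b 0 = 1 := by simp [b]
  have hsum : ∑ h ∈ Finset.Icc 1 k, (a h + b h) * b (k + 2 - h - 1) =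
      ∑ i ∈ Finset.range k, (a (i + 1) + b (i + 1)) * b (k - i) := by
    rw [← Finset.Ico_add_one_right_eq_Icc, Finset.sum_Ico_eq_sum_range]
    refine Finset.sum_congr rfl fun i _ => ?_
    rw [add_comm 1 i, show k + 2 - (i + 1) - 1 = k - i by omega]
  rw [b_succ_eq_sum_antidiagonal, Finset.Nat.sum_antidiagonal_eq_sum_range_succ_mk,
    Finset.sum_range_succ, Finset.sum_range_succ', show k + 2 - 2 = k by omega,
    show k + 2 - 1 = k + 1 by omega, hsum]
  simp only [Nat.add_sub_add_right, Nat.sub_zero, Nat.sub_self, ha, hb]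
  ring
end

section
/- Define T_n = (1/(2n+1))·binom(3n, n) and U_n = (1/(n+1))·binom(3n+1, n) as rational numbers, with T_0 = U_0 = 1. For every integer n ≥ 1, 2·Σ_{h=0}^{n−1} (1/(h+1))·T_h·T_{n−h−1} = 3·U_{n−1} − T_n (an identity of rational numbers). -/
/-- The Fuss–Catalan number T_n = (1/(2n+1))·binom(3n, n), as a rational number. -/
noncomputable def T (n : ℕ) : ℚ := (1 / (2 * (n : ℚ) + 1)) * Nat.choose (3 * n) n

/-- The Raney number U_n = R_n^{(3,2)} = (1/(n+1))·binom(3n+1, n), as a rational number. -/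
noncomputable def U (n : ℕ) : ℚ := (1 / ((n : ℚ) + 1)) * Nat.choose (3 * n + 1) n

/-- The coefficient `r / (r + 3n) · binom(r + 3n, n)` of `xⁿ` in `Bʳ`, where `B = 1 + x B³`,
written without denominators so that it makes sense for every integer `r`. -/
def raney : ℕ → ℤ → ℤ
  | 0, _ => 1
  | n + 1, r => Ring.choose (r + 3 * n + 3) (n + 1) - 3 * Ring.choose (r + 3 * n + 2) n

@[simp]
theorem raney_zero_left (r : ℤ) : raney 0 r = 1 := rfl

theorem raney_succ_add_one (n : ℕ) (r : ℤ) :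
    raney (n + 1) (r + 1) = raney (n + 1) r + raney n (r + 3) := by
  cases n with
  | zero => simp [raney]
  | succ n =>
    have h₁ := Ring.choose_succ_succ (r + 3 * n + 6) (n + 1)
    have h₂ := Ring.choose_succ_succ (r + 3 * n + 5) n
    simp only [raney]
    push_cast
    ring_nf at h₁ h₂ ⊢
    linarith

theorem raney_succ_zero (n : ℕ) : raney (n + 1) 0 = 0 := by
  have h := Nat.add_one_mul_choose_eq (3 * n + 2) n
  have h₁ : Ring.choose (0 + 3 * n + 3 : ℤ) (n + 1) = ((3 * n + 2 + 1).choose (n + 1) : ℕ) := by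
    rw [← Ring.choose_natCast]; push_cast; ring_nf
  have h₂ : Ring.choose (0 + 3 * n + 2 : ℤ) n = ((3 * n + 2).choose n : ℕ) := by
    rw [← Ring.choose_natCast]; push_cast; ring_nf
  rw [raney, h₁, h₂]
  zify at h
  have hn : (n + 1 : ℤ) ≠ 0 := by positivity
  apply mul_left_cancel₀ hn
  linear_combination -h

/-- The Rothe–Hagen convolution identity of order 3, at integer parameters. -/
theorem sum_antidiagonal_raney_mul_raney (n : ℕ) (r s : ℤ) :
    ∑ p ∈ Finset.HasAntidiagonal.antidiagonal n, raney p.1 r * raney p.2 s = raney n (r + s) := by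
  induction n generalizing r with
  | zero => simp
  | succ n ih =>
    have step (r : ℤ) :
        ∑ p ∈ Finset.HasAntidiagonal.antidiagonal (n + 1), raney p.1 (r + 1) * raney p.2 s =
          ∑ p ∈ Finset.HasAntidiagonal.antidiagonal (n + 1), raney p.1 r * raney p.2 s + raney n (r + s + 3) := by
      simp only [Finset.Nat.sum_antidiagonal_succ, raney_succ_add_one, add_mul,
        Finset.sum_add_distrib, ih, add_right_comm r s 3]
      simp only [raney_zero_left]
      ring
    induction r using Int.induction_on with
    | zero => simp [Finset.Nat.sum_antidiagonal_succ, raney_succ_zero]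
    | succ i hi => rw [step, hi, add_right_comm (i : ℤ) 1 s, raney_succ_add_one]
    | pred i hi =>
      have h₁ := step (-i - 1)
      have h₂ := raney_succ_add_one n (-i - 1 + s)
      rw [sub_add_cancel] at h₁
      rw [show (-i - 1 + s + 1 : ℤ) = -i + s by ring] at h₂
      linarith

theorem sum_range_raney_succ_mul_raney (n : ℕ) (r s : ℤ) :
    ∑ h ∈ Finset.range (n + 1), raney (h + 1) r * raney (n - h) s =
      raney (n + 1) (r + s) - raney (n + 1) s := by
  rw [← sum_antidiagonal_raney_mul_raney (n + 1) r s, Finset.Nat.sum_antidiagonal_succ,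
    Finset.Nat.sum_antidiagonal_eq_sum_range_succ_mk]
  simp

theorem raney_succ_mul {n N : ℕ} {r : ℤ} (hN : (N : ℤ) = r + 3 * n + 2) :
    ((N : ℤ) + 1) * raney (n + 1) r = r * (N + 1).choose (n + 1) := by
  have h := Nat.add_one_mul_choose_eq N n
  zify at h
  rw [raney, ← hN, show r + 3 * n + 3 = ((N + 1 : ℕ) : ℤ) by push_cast; linarith,
    Ring.choose_natCast, Ring.choose_natCast]
  linear_combination -3 * h + ((N + 1).choose (n + 1) : ℤ) * hN

theorem raney_one (n : ℕ) : (raney n 1 : ℚ) = T n := by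
  cases n with
  | zero => simp [T]
  | succ n =>
    have h := raney_succ_mul (n := n) (N := 3 * n + 3) (r := 1) (by push_cast; ring)
    have h' := Nat.choose_mul_succ_eq (3 * n + 3) (n + 1)
    rw [show 3 * n + 3 + 1 - (n + 1) = 2 * n + 3 by lia] at h'
    qify at h h'
    rw [T, show 3 * (n + 1) = 3 * n + 3 by ring]
    push_cast
    field_simp
    have hn : (3 * n + 4 : ℚ) ≠ 0 := by positivity
    apply mul_left_cancel₀ hn
    linear_combination (2 * n + 3 : ℚ) * h - h'

theorem raney_succ_neg_one (n : ℕ) : (raney (n + 1) (-1) : ℚ) = -U n := by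
  have h := raney_succ_mul (n := n) (N := 3 * n + 1) (r := -1) (by push_cast; ring)
  have h' := Nat.add_one_mul_choose_eq (3 * n + 1) n
  qify at h h'
  rw [U]
  field_simp
  have hn : (3 * n + 2 : ℚ) ≠ 0 := by positivity
  apply mul_left_cancel₀ hn
  linear_combination (n + 1 : ℚ) * h + h'

theorem T_div_succ (n : ℕ) :
    1 / ((n : ℚ) + 1) * T n = -(3 / 2) * raney (n + 1) (-2) + 2 * raney (n + 1) (-1) := by
  have h := raney_succ_mul (n := n) (N := 3 * n) (r := -2) (by push_cast; ring)
  have h' := Nat.add_one_mul_choose_eq (3 * n) n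
  have h₂ := Nat.choose_mul_succ_eq (3 * n) n
  rw [show 3 * n + 1 - n = 2 * n + 1 by lia] at h₂
  qify at h h' h₂
  have hn : (3 * n + 1 : ℚ) ≠ 0 := by positivity
  have e₁ : (raney (n + 1) (-2) : ℚ) = -2 / (n + 1) * (3 * n).choose n := by
    field_simp
    apply mul_left_cancel₀ hn
    linear_combination (n + 1 : ℚ) * h + 2 * h'
  have e₂ : ((3 * n + 1).choose n : ℚ) = (3 * n + 1) / (2 * n + 1) * (3 * n).choose n := by
    field_simp
    linear_combination -h₂
  rw [raney_succ_neg_one, e₁, T, U, e₂]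
  field_simp
  ring

/-- 2·Σ_{h=0}^{n-1} (1/(h+1))·T_h·T_{n-h-1} = 3·U_{n-1} − T_n for n ≥ 1. -/
theorem sum_T_identity (n : ℕ) (hn : 1 ≤ n) :
    2 * ∑ h ∈ Finset.range n, (1 / ((h : ℚ) + 1)) * T h * T (n - h - 1) =
      3 * U (n - 1) - T n := by
  obtain ⟨m, rfl⟩ := Nat.exists_eq_add_of_le' hn
  have h₁ := sum_range_raney_succ_mul_raney m (-2) 1
  have h₂ := sum_range_raney_succ_mul_raney m (-1) 1
  norm_num [raney_succ_zero] at h₁ h₂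
  qify at h₁ h₂
  simp only [raney_one] at h₁ h₂
  have hsum : ∑ h ∈ Finset.range (m + 1), 1 / ((h : ℚ) + 1) * T h * T (m + 1 - h - 1) =
      -(3 / 2) * ∑ h ∈ Finset.range (m + 1), (raney (h + 1) (-2) : ℚ) * T (m - h) +
        2 * ∑ h ∈ Finset.range (m + 1), (raney (h + 1) (-1) : ℚ) * T (m - h) := by
    rw [Finset.mul_sum, Finset.mul_sum, ← Finset.sum_add_distrib]
    refine Finset.sum_congr rfl fun h _ => ?_
    rw [T_div_succ, Nat.sub_right_comm, Nat.add_sub_cancel]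
    ring
  rw [hsum, h₁, h₂, raney_succ_neg_one, Nat.add_sub_cancel]
  ring
end
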